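/- Let n ≥ 2 and suppose V : ℝⁿ → ℝ is a nonnegative continuous radial function with V(x) ≤ C⟨|x|⟩^{−ω} for some constant C > 0 and some ω > 2, which is Hölder continuous of some exponent δ > 0 on the ball B_δ, and which is nontrivial when n = 2. Then there exists a C² function φ₀ : ℝⁿ → ℝ solving Δφ₀ = V φ₀ on ℝⁿ and positive constants c₁, c₂ such that c₁ · ln(|x|+2) ≤ φ₀(x) ≤ c₂ · ln(|x|+2) for all x when n = 2, and c₁ ≤ φ₀(x) ≤ c₂ for all x when n ≥ 3. -/

import Mathlib

open MeasureTheory Real Set Metric NNReal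

noncomputable section

/-- The Laplacian of `f : ℝⁿ → ℝ`. -/
def lap {n : ℕ} (f : EuclideanSpace ℝ (Fin n) → ℝ) (x : EuclideanSpace ℝ (Fin n)) : ℝ :=
  ∑ i : Fin n, fderiv ℝ (fun y => fderiv ℝ f y (EuclideanSpace.single i 1)) x
    (EuclideanSpace.single i 1)

open Filter Topology Asymptotics

def HH (m : ℕ) (q f : ℝ → ℝ) (r : ℝ) : ℝ := ∫ t in (0:ℝ)..1, t ^ m * q (r * t) * f (r * t)

def LL (m : ℕ) (q f : ℝ → ℝ) (r : ℝ) : ℝ := r ^ 2 * ∫ u in (0:ℝ)..1, u * HH m q f (r * u)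

lemma HH_cont (m : ℕ) (q f : ℝ → ℝ) (hq : Continuous q) (hf : Continuous f) :
    Continuous (HH m q f) := by
  unfold HH
  apply intervalIntegral.continuous_parametric_intervalIntegral_of_continuous'
  simp only [Function.uncurry_def]
  fun_prop

lemma LL_cont (m : ℕ) (q f : ℝ → ℝ) (hq : Continuous q) (hf : Continuous f) :
    Continuous (LL m q f) := by
  unfold LL
  have := HH_cont m q f hq hf
  refine (continuous_pow 2).mul ?_
  apply intervalIntegral.continuous_parametric_intervalIntegral_of_continuous'
  simp only [Function.uncurry_def]
  fun_prop

lemma HH_sub (m : ℕ) (q f g : ℝ → ℝ) (hq : Continuous q) (hf : Continuous f) (hg : Continuous g)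
    (r : ℝ) : HH m q (fun x => f x - g x) r = HH m q f r - HH m q g r := by
  unfold HH
  rw [← intervalIntegral.integral_sub]
  · congr 1; ext t; ring
  · apply Continuous.intervalIntegrable; fun_prop
  · apply Continuous.intervalIntegrable; fun_prop

lemma LL_sub (m : ℕ) (q f g : ℝ → ℝ) (hq : Continuous q) (hf : Continuous f) (hg : Continuous g)
    (r : ℝ) : LL m q (fun x => f x - g x) r = LL m q f r - LL m q g r := by
  unfold LL
  have h1 := HH_cont m q f hq hf
  have h2 := HH_cont m q g hq hg
  rw [← mul_sub, ← intervalIntegral.integral_sub]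
  · congr 2; ext t; rw [HH_sub m q f g hq hf hg]; ring
  · apply Continuous.intervalIntegrable; fun_prop
  · apply Continuous.intervalIntegrable; fun_prop

lemma HH_nonneg (m : ℕ) (q f : ℝ → ℝ) (hq : ∀ x, 0 ≤ q x) (hf : ∀ x, 0 ≤ f x) (r : ℝ) :
    0 ≤ HH m q f r := by
  unfold HH
  apply intervalIntegral.integral_nonneg zero_le_one
  intro t ht
  have := hq (r * t)
  have := hf (r * t)
  have := ht.1
  positivity

lemma LL_nonneg (m : ℕ) (q f : ℝ → ℝ) (hq : ∀ x, 0 ≤ q x) (hf : ∀ x, 0 ≤ f x) (r : ℝ) :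
    0 ≤ LL m q f r := by
  unfold LL
  refine mul_nonneg (sq_nonneg _) ?_
  apply intervalIntegral.integral_nonneg zero_le_one
  intro t ht
  exact mul_nonneg ht.1 (HH_nonneg m q f hq hf _)

lemma HH_bound (m : ℕ) (q f : ℝ → ℝ) (hq0 : ∀ x, 0 ≤ q x) (C D : ℝ) (hC : 0 < C) (hD : 0 ≤ D)
    (hqC : ∀ x, q x ≤ C) (hfD : ∀ x, |f x| ≤ D * Real.exp (C * x ^ 2)) (r : ℝ) :
    |HH m q f r| ≤ C * D * Real.exp (C * r ^ 2) := by
  have := intervalIntegral.norm_integral_le_of_norm_le_const (a := (0:ℝ)) (b := 1)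
    (f := fun t => t ^ m * q (r * t) * f (r * t)) (C := C * D * Real.exp (C * r ^ 2)) ?_
  · simpa [HH] using this
  · intro t ht
    rw [Set.uIoc_of_le zero_le_one] at ht
    have h0 := ht.1.le
    have h1 : t ^ m ≤ 1 := pow_le_one₀ ht.1.le ht.2
    have h2 : |f (r * t)| ≤ D * Real.exp (C * r ^ 2) := by
      refine (hfD _).trans ?_
      have h3 : t ^ 2 ≤ 1 := pow_le_one₀ ht.1.le ht.2
      have h4 : (r * t) ^ 2 ≤ r ^ 2 := by nlinarith [sq_nonneg r]
      gcongr
    rw [Real.norm_eq_abs, abs_mul, abs_mul, abs_of_nonneg (hq0 _), abs_of_nonneg (pow_nonneg h0 m)]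
    calc t ^ m * q (r * t) * |f (r * t)| ≤ 1 * C * (D * Real.exp (C * r ^ 2)) := by
          have := hq0 (r * t)
          have := hqC (r * t)
          gcongr
      _ = _ := by ring

lemma LL_bound (m : ℕ) (q f : ℝ → ℝ) (hq : Continuous q) (hf : Continuous f)
    (hq0 : ∀ x, 0 ≤ q x) (C D : ℝ) (hC : 0 < C) (hD : 0 ≤ D)
    (hqC : ∀ x, q x ≤ C) (hfD : ∀ x, |f x| ≤ D * Real.exp (C * x ^ 2)) (r : ℝ) :
    |LL m q f r| ≤ D / 2 * Real.exp (C * r ^ 2) := by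
  have hH := HH_cont m q f hq hf
  have h1 : |∫ u in (0:ℝ)..1, u * HH m q f (r * u)| ≤
      ∫ u in (0:ℝ)..1, u * (C * D * Real.exp (C * (r * u) ^ 2)) := by
    rw [← Real.norm_eq_abs]
    apply intervalIntegral.norm_integral_le_of_norm_le zero_le_one
    · filter_upwards with t ht
      rw [Real.norm_eq_abs, abs_mul, abs_of_nonneg ht.1.le]
      exact mul_le_mul_of_nonneg_left (HH_bound m q f hq0 C D hC hD hqC hfD _) ht.1.le
    · apply Continuous.intervalIntegrable; fun_prop
  have h2 : ∫ u in (0:ℝ)..1, r ^ 2 * (u * (C * D * Real.exp (C * (r * u) ^ 2))) =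
      D / 2 * Real.exp (C * (r * 1) ^ 2) - D / 2 * Real.exp (C * (r * 0) ^ 2) := by
    apply intervalIntegral.integral_eq_sub_of_hasDerivAt
      (f := fun u => D / 2 * Real.exp (C * (r * u) ^ 2))
    · intro u _
      have h := (((((hasDerivAt_id u).const_mul r).pow 2).const_mul C).exp).const_mul (D / 2)
      refine h.congr_deriv ?_
      simp
      ring
    · apply Continuous.intervalIntegrable; fun_prop
  unfold LL
  rw [abs_mul, abs_of_nonneg (sq_nonneg r)]
  refine (mul_le_mul_of_nonneg_left h1 (sq_nonneg r)).trans ?_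
  rw [← intervalIntegral.integral_const_mul, h2]
  have : 0 < Real.exp (C * (r * 0) ^ 2) := Real.exp_pos _
  rw [mul_one]
  nlinarith

open BoundedContinuousFunction in
lemma exists_fix (m : ℕ) (q : ℝ → ℝ) (hq : Continuous q)
    (hq0 : ∀ x, 0 ≤ q x) (C : ℝ) (hC : 0 < C) (hqC : ∀ x, q x ≤ C) :
    ∃ φ : ℝ → ℝ, Continuous φ ∧ (∀ r, 1 ≤ φ r) ∧ ∀ r, φ r = 1 + LL m q φ r := by
  let w : (ℝ →ᵇ ℝ) → ℝ → ℝ := fun ψ x => |Real.exp (C * x ^ 2) * ψ x|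
  have hwc : ∀ ψ, Continuous (w ψ) := fun ψ => by
    have := ψ.continuous
    show Continuous (fun x => |Real.exp (C * x ^ 2) * ψ x|)
    fun_prop
  have hwb : ∀ ψ x, |w ψ x| ≤ ‖ψ‖ * Real.exp (C * x ^ 2) := fun ψ x => by
    have := ψ.norm_coe_le_norm x
    rw [Real.norm_eq_abs] at this
    simp only [w, abs_abs, abs_mul, Real.abs_exp]
    rw [mul_comm]; gcongr
  have hwd : ∀ ψ₁ ψ₂ x, |w ψ₁ x - w ψ₂ x| ≤ dist ψ₁ ψ₂ * Real.exp (C * x ^ 2) := fun ψ₁ ψ₂ x => by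
    refine (abs_abs_sub_abs_le_abs_sub _ _).trans ?_
    rw [← mul_sub, abs_mul, Real.abs_exp, mul_comm]
    gcongr
    exact dist_coe_le_dist (f := ψ₁) (g := ψ₂) x
  have key : ∀ D a r, |a| ≤ D * Real.exp (C * r ^ 2) → |Real.exp (-(C * r ^ 2)) * a| ≤ D := by
    intro D a r h
    rw [abs_mul, Real.abs_exp, Real.exp_neg, inv_mul_le_iff₀ (Real.exp_pos _), mul_comm]
    exact h
  have hTb : ∀ ψ r, ‖Real.exp (-(C * r ^ 2)) * (1 + LL m q (w ψ) r)‖ ≤ 1 + ‖ψ‖ / 2 := by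
    intro ψ r
    apply key
    have h1 := LL_bound m q (w ψ) hq (hwc ψ) hq0 C ‖ψ‖ hC (norm_nonneg _) hqC (hwb ψ) r
    have h2 : 1 ≤ Real.exp (C * r ^ 2) := Real.one_le_exp (by positivity)
    refine (abs_add_le _ _).trans ?_
    rw [abs_one]; linarith
  let T : (ℝ →ᵇ ℝ) → (ℝ →ᵇ ℝ) := fun ψ => BoundedContinuousFunction.ofNormedAddCommGroup
    (fun r => Real.exp (-(C * r ^ 2)) * (1 + LL m q (w ψ) r))
    (by have := LL_cont m q (w ψ) hq (hwc ψ); fun_prop) (1 + ‖ψ‖ / 2) (hTb ψ)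
  have hT : ContractingWith (1/2 : ℝ≥0) T := by
    refine ⟨?_, ?_⟩
    · rw [← NNReal.coe_lt_coe]; norm_num
    · apply LipschitzWith.of_dist_le_mul
      intro ψ₁ ψ₂
      rw [BoundedContinuousFunction.dist_le (by positivity)]
      intro r
      have h1 := LL_bound m q (fun x => w ψ₁ x - w ψ₂ x) hq ((hwc ψ₁).sub (hwc ψ₂)) hq0 C
        (dist ψ₁ ψ₂) hC dist_nonneg hqC (hwd ψ₁ ψ₂) r
      rw [LL_sub m q _ _ hq (hwc ψ₁) (hwc ψ₂)] at h1
      have h2 := key _ _ _ h1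
      rw [Real.dist_eq]
      show |Real.exp (-(C * r ^ 2)) * (1 + LL m q (w ψ₁) r)
        - Real.exp (-(C * r ^ 2)) * (1 + LL m q (w ψ₂) r)| ≤ _
      have h3 : ((1/2 : ℝ≥0) : ℝ) = 1/2 := by norm_num
      rw [h3]
      convert h2 using 1
      · congr 1; ring
      · ring
  let ψ := ContractingWith.fixedPoint T hT
  have hψ : T ψ = ψ := ContractingWith.fixedPoint_isFixedPt hT
  have h1 : ∀ r, Real.exp (C * r ^ 2) * ψ r = 1 + LL m q (w ψ) r := by
    intro r
    have : T ψ r = ψ r := by rw [hψ]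
    have h2 : T ψ r = Real.exp (-(C * r ^ 2)) * (1 + LL m q (w ψ) r) := rfl
    rw [← this, h2, ← mul_assoc, ← Real.exp_add]
    simp
  have h2 : ∀ r, 1 ≤ 1 + LL m q (w ψ) r := fun r => by
    have := LL_nonneg m q (w ψ) hq0 (fun x => abs_nonneg _) r
    linarith
  have h3 : w ψ = fun r => 1 + LL m q (w ψ) r := by
    ext r
    show |Real.exp (C * r ^ 2) * ψ r| = _
    rw [h1, abs_of_nonneg (zero_le_one.trans (h2 r))]
  refine ⟨w ψ, hwc ψ, fun r => ?_, fun r => ?_⟩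
  · rw [h3]; exact h2 r
  · exact congrFun h3 r

lemma exists_phi (m : ℕ) (q : ℝ → ℝ) (hq : Continuous q)
    (hq0 : ∀ x, 0 ≤ q x) (C : ℝ) (hC : 0 < C) (hqC : ∀ x, q x ≤ C) :
    ∃ φ : ℝ → ℝ, Continuous φ ∧ (∀ r, 1 ≤ φ r) ∧
      (∀ r, HasDerivAt φ (r * HH m q φ r) r) ∧
      (∀ r, HasDerivAt (fun r => r ^ (m + 1) * HH m q φ r) (r ^ m * (q r * φ r)) r) := by
  obtain ⟨φ, hc, h1, hfix⟩ := exists_fix m q hq hq0 C hC hqC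
  have hH := HH_cont m q φ hq hc
  refine ⟨φ, hc, h1, fun r => ?_, fun r => ?_⟩
  · have e : φ = fun r => 1 + ∫ s in (0:ℝ)..r, s * HH m q φ s := by
      ext r
      rw [hfix r, LL]
      have := intervalIntegral.mul_integral_comp_mul_left (a := (0:ℝ)) (b := 1)
        (f := fun s => s * HH m q φ s) (c := r)
      simp only [mul_zero, mul_one] at this
      rw [← this, pow_two, mul_assoc, ← intervalIntegral.integral_const_mul]
      simp only [mul_assoc]
    have hcont : Continuous (fun s => s * HH m q φ s) := by fun_prop
    have := (hcont.integral_hasStrictDerivAt 0 r).hasDerivAt.const_add 1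
    rw [← e] at this
    exact this
  · have e : (fun r => r ^ (m + 1) * HH m q φ r) =
        fun r => ∫ s in (0:ℝ)..r, s ^ m * (q s * φ s) := by
      ext r
      have := intervalIntegral.mul_integral_comp_mul_left (a := (0:ℝ)) (b := 1)
        (f := fun s => s ^ m * (q s * φ s)) (c := r)
      simp only [mul_zero, mul_one] at this
      rw [← this, pow_succ', mul_assoc, HH, ← intervalIntegral.integral_const_mul]
      simp only [mul_pow, mul_assoc]
    rw [e]
    have hcont : Continuous (fun s => s ^ m * (q s * φ s)) := by fun_prop
    exact (hcont.integral_hasStrictDerivAt 0 r).hasDerivAt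

lemma HH_zero (m : ℕ) (q f : ℝ → ℝ) : ((m + 1 : ℕ) : ℝ) * HH m q f 0 = q 0 * f 0 := by
  simp only [HH, zero_mul, mul_assoc]
  rw [intervalIntegral.integral_mul_const, integral_pow]
  have : (m : ℝ) + 1 ≠ 0 := by positivity
  push_cast
  field_simp
  simp

section radial
variable {n : ℕ}

lemma hasFDerivAt_norm_aux (x : EuclideanSpace ℝ (Fin n)) (hx : x ≠ 0) :
    HasFDerivAt (fun y : EuclideanSpace ℝ (Fin n) => ‖y‖) (‖x‖⁻¹ • innerSL ℝ x) x := by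
  have h := (hasStrictFDerivAt_norm_sq x).hasFDerivAt.sqrt (by positivity)
  simp only [Real.sqrt_sq (norm_nonneg _)] at h
  refine h.congr_fderiv ?_
  ext v
  simp
  ring

lemma hasFDerivAt_phi (φ h : ℝ → ℝ) (hφ : ∀ r, HasDerivAt φ (r * h r) r)
    (x : EuclideanSpace ℝ (Fin n)) :
    HasFDerivAt (fun y : EuclideanSpace ℝ (Fin n) => φ ‖y‖) (innerSL ℝ (h ‖x‖ • x)) x := by
  by_cases hx : x = 0
  · subst hx
    have h0 := hφ 0
    rw [zero_mul, hasDerivAt_iff_isLittleO_nhds_zero] at h0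
    have h1 := h0.comp_tendsto (tendsto_norm_zero (E := EuclideanSpace ℝ (Fin n)))
    rw [hasFDerivAt_iff_isLittleO_nhds_zero]
    have h2 := isLittleO_norm_right.1 h1
    simpa [Function.comp_def] using h2
  · have h1 := (hφ ‖x‖).comp_hasFDerivAt x (hasFDerivAt_norm_aux x hx)
    refine h1.congr_fderiv ?_
    have : ‖x‖ ≠ 0 := norm_ne_zero_iff.2 hx
    ext v
    simp
    field_simp

/-- Derivative of `x ↦ h ‖x‖ • x`. -/
def AA (h p : ℝ → ℝ) (x : EuclideanSpace ℝ (Fin n)) :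
    EuclideanSpace ℝ (Fin n) →L[ℝ] EuclideanSpace ℝ (Fin n) :=
  h ‖x‖ • ContinuousLinearMap.id ℝ _ +
    ((p ‖x‖ - n * h ‖x‖) * (‖x‖⁻¹) ^ 2) • (innerSL ℝ x).smulRight x

lemma hasFDerivAt_G (h p : ℝ → ℝ) (hh : Continuous h) (hn : 1 ≤ n)
    (hF : ∀ r, HasDerivAt (fun r => r ^ n * h r) (r ^ (n - 1) * p r) r)
    (x : EuclideanSpace ℝ (Fin n)) :
    HasFDerivAt (fun y : EuclideanSpace ℝ (Fin n) => h ‖y‖ • y) (AA h p x) x := by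
  by_cases hx : x = 0
  · subst hx
    have hA : AA h p (0 : EuclideanSpace ℝ (Fin n)) = h 0 • ContinuousLinearMap.id ℝ _ := by
      simp [AA]
    rw [hA, hasFDerivAt_iff_isLittleO_nhds_zero]
    have h1 : (fun y : EuclideanSpace ℝ (Fin n) => h ‖y‖ - h 0) =o[𝓝 0] (fun _ => (1:ℝ)) := by
      rw [isLittleO_one_iff]
      have : Continuous (fun y : EuclideanSpace ℝ (Fin n) => h ‖y‖ - h 0) := by fun_prop
      simpa using this.tendsto 0
    have h2 := h1.smul_isBigO (isBigO_refl (fun y : EuclideanSpace ℝ (Fin n) => y) (𝓝 0))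
    simpa [sub_smul] using h2
  · have hr : 0 < ‖x‖ := norm_pos_iff.2 hx
    have hd : HasDerivAt h ((p ‖x‖ - n * h ‖x‖) / ‖x‖) ‖x‖ := by
      have h1 := (hF ‖x‖).div (hasDerivAt_pow n ‖x‖) (by positivity)
      have h2 : HasDerivAt h ((‖x‖ ^ (n - 1) * p ‖x‖ * ‖x‖ ^ n -
          ‖x‖ ^ n * h ‖x‖ * (↑n * ‖x‖ ^ (n - 1))) / (‖x‖ ^ n) ^ 2) ‖x‖ := by
        refine h1.congr_of_eventuallyEq ?_
        filter_upwards [lt_mem_nhds hr] with s hs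
        simp only [Pi.div_apply]
        field_simp
      convert h2 using 1
      obtain ⟨k, rfl⟩ : ∃ k, n = k + 1 := ⟨n - 1, by omega⟩
      simp only [Nat.add_sub_cancel]
      field_simp
      ring
    have h1 := (hd.comp_hasFDerivAt x (hasFDerivAt_norm_aux x hx)).smul (hasFDerivAt_id x)
    refine h1.congr_fderiv ?_
    ext v i
    simp [AA]
    field_simp

lemma AA_cont (h p : ℝ → ℝ) (hh : Continuous h) (hp : Continuous p) (h0 : n * h 0 = p 0) :
    Continuous (AA h p : EuclideanSpace ℝ (Fin n) → _) := by
  unfold AA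
  refine Continuous.add (by fun_prop) ?_
  rw [continuous_iff_continuousAt]
  intro x
  by_cases hx : x = 0
  · subst hx
    rw [ContinuousAt]
    simp only [norm_zero, map_zero, ContinuousLinearMap.zero_smulRight, smul_zero]
    have hc : Continuous (fun y : EuclideanSpace ℝ (Fin n) => ‖p ‖y‖ - n * h ‖y‖‖) := by fun_prop
    have ht := hc.tendsto 0
    simp only [norm_zero, h0, sub_self] at ht
    refine squeeze_zero_norm (fun y => ?_) ht
    rw [norm_smul, ContinuousLinearMap.norm_smulRight_apply, innerSL_apply_norm, norm_mul]
    by_cases hy : y = 0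
    · simp [hy]
    · have : ‖y‖ ≠ 0 := norm_ne_zero_iff.2 hy
      apply le_of_eq
      simp
      field_simp
  · have : ‖x‖ ≠ 0 := norm_ne_zero_iff.2 hx
    have h1 : ContinuousAt (fun y : EuclideanSpace ℝ (Fin n) => ‖y‖⁻¹) x :=
      continuous_norm.continuousAt.inv₀ this
    refine ContinuousAt.smul (ContinuousAt.mul (by fun_prop) (h1.pow 2)) ?_
    have : Continuous (fun y : EuclideanSpace ℝ (Fin n) => (innerSL ℝ y).smulRight y) := by
      fun_prop
    exact this.continuousAt

lemma radial_main (φ h p : ℝ → ℝ) (hh : Continuous h) (hp : Continuous p) (hn : 1 ≤ n)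
    (h0 : n * h 0 = p 0) (hφ : ∀ r, HasDerivAt φ (r * h r) r)
    (hF : ∀ r, HasDerivAt (fun r => r ^ n * h r) (r ^ (n - 1) * p r) r) :
    ContDiff ℝ 2 (fun y : EuclideanSpace ℝ (Fin n) => φ ‖y‖) ∧
    ∀ x, lap (fun y : EuclideanSpace ℝ (Fin n) => φ ‖y‖) x = p ‖x‖ := by
  have hfd : fderiv ℝ (fun y : EuclideanSpace ℝ (Fin n) => φ ‖y‖) =
      fun x => innerSL ℝ (h ‖x‖ • x) := by
    ext1 x; exact (hasFDerivAt_phi φ h hφ x).fderiv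
  have hG := hasFDerivAt_G h p hh hn hF
  constructor
  · rw [show (2 : WithTop ℕ∞) = 1 + 1 by norm_num, contDiff_succ_iff_fderiv]
    refine ⟨fun x => (hasFDerivAt_phi φ h hφ x).differentiableAt, by simp, ?_⟩
    rw [hfd]
    have : ContDiff ℝ 1 (fun y : EuclideanSpace ℝ (Fin n) => h ‖y‖ • y) := by
      rw [contDiff_one_iff_fderiv]
      refine ⟨fun x => (hG x).differentiableAt, ?_⟩
      have e : fderiv ℝ (fun y : EuclideanSpace ℝ (Fin n) => h ‖y‖ • y) = AA h p := by
        ext1 x; exact (hG x).fderiv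
      rw [e]; exact AA_cont h p hh hp h0
    exact (innerSL ℝ (E := EuclideanSpace ℝ (Fin n))).contDiff.comp this
  · intro x
    have hi : ∀ i : Fin n, fderiv ℝ (fun y => fderiv ℝ (fun y : EuclideanSpace ℝ (Fin n) => φ ‖y‖) y
        (EuclideanSpace.single i 1)) x (EuclideanSpace.single i 1) =
        h ‖x‖ + ((p ‖x‖ - n * h ‖x‖) * (‖x‖⁻¹) ^ 2) * x i ^ 2 := by
      intro i
      rw [hfd]
      have e : (fun y : EuclideanSpace ℝ (Fin n) =>
          (innerSL ℝ (h ‖y‖ • y)) (EuclideanSpace.single i (1:ℝ))) =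
          fun y => (EuclideanSpace.proj i : EuclideanSpace ℝ (Fin n) →L[ℝ] ℝ) (h ‖y‖ • y) := by
        ext y
        simp [EuclideanSpace.inner_single_right]
      have h1 := (EuclideanSpace.proj i : EuclideanSpace ℝ (Fin n) →L[ℝ] ℝ).hasFDerivAt.comp x (hG x)
      simp only [Function.comp_def] at h1
      rw [e, h1.fderiv]
      simp [AA, EuclideanSpace.inner_single_right]
      ring_nf
      simp
    unfold lap
    rw [Finset.sum_congr rfl (fun i _ => hi i), Finset.sum_add_distrib, ← Finset.mul_sum,
      ← EuclideanSpace.real_norm_sq_eq]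
    by_cases hx : x = 0
    · subst hx; simp [h0]
    · have : ‖x‖ ≠ 0 := norm_ne_zero_iff.2 hx
      simp
      field_simp
      ring
end radial

lemma gronwall_aux (u du : ℝ → ℝ) (a A ε : ℝ) (ha : 0 ≤ a) (hA : 0 ≤ A) (hε : 0 < ε)
    (hu : ∀ r, HasDerivAt u (du r) r) (hu0 : ∀ r, a ≤ r → 0 ≤ u r)
    (hle : ∀ r, a ≤ r → du r ≤ A * (1 + r) ^ (-1 - ε) * u r) (r : ℝ) (hr : a ≤ r) :
    u r ≤ u a * Real.exp (A / ε) := by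
  let E : ℝ → ℝ := fun r => Real.exp (A / ε * (1 + r) ^ (-ε))
  have hE : ∀ r, a ≤ r → HasDerivAt E (- (A * (1 + r) ^ (-1 - ε)) * E r) r := by
    intro r hr
    have hpos : 0 < 1 + r := by linarith
    have h1 : HasDerivAt (fun r : ℝ => 1 + r) 1 r := (hasDerivAt_id r).const_add 1
    have h2 := ((h1.rpow_const (p := -ε) (Or.inl hpos.ne')).const_mul (A / ε)).exp
    convert h2 using 1
    rw [show -ε - 1 = -1 - ε by ring]
    simp only [E]
    field_simp
  have hanti : AntitoneOn (fun r => u r * E r) (Ici a) := by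
    apply antitoneOn_of_deriv_nonpos (convex_Ici a)
    · intro x hx
      exact ((hu x).mul (hE x hx)).continuousAt.continuousWithinAt
    · intro x hx
      rw [interior_Ici] at hx
      exact ((hu x).mul (hE x (le_of_lt hx))).differentiableAt.differentiableWithinAt
    · intro x hx
      rw [interior_Ici] at hx
      have := hle x (le_of_lt hx)
      have h2 : 0 < E x := Real.exp_pos _
      have h3 := ((hu x).mul (hE x (le_of_lt hx))).deriv
      change deriv (fun r => u r * E r) x = _ at h3
      rw [h3]
      nlinarith
  have h1 := hanti (self_mem_Ici) hr hr
  simp only at h1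
  have h2 : 1 ≤ E r := Real.one_le_exp (mul_nonneg (by positivity)
    (Real.rpow_nonneg (by linarith) _))
  have h3 : E a ≤ Real.exp (A / ε) := by
    apply Real.exp_le_exp.2
    apply mul_le_of_le_one_right (by positivity)
    exact Real.rpow_le_one_of_one_le_of_nonpos (by linarith) (by linarith)
  calc u r ≤ u r * E r := le_mul_of_one_le_right (hu0 r hr) h2
    _ ≤ u a * E a := h1
    _ ≤ _ := mul_le_mul_of_nonneg_left h3 (hu0 a le_rfl)

lemma mono_aux (u du : ℝ → ℝ) (a : ℝ) (hu : ∀ r, a ≤ r → HasDerivAt u (du r) r)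
    (h : ∀ r, a ≤ r → 0 ≤ du r) : MonotoneOn u (Ici a) := by
  apply monotoneOn_of_deriv_nonneg (convex_Ici a)
  · intro x hx
    exact (hu x hx).continuousAt.continuousWithinAt
  · intro x hx
    rw [interior_Ici] at hx
    exact (hu x (le_of_lt hx)).differentiableAt.differentiableWithinAt
  · intro x hx
    rw [interior_Ici] at hx
    rw [(hu x (le_of_lt hx)).deriv]
    exact h x (le_of_lt hx)

lemma case3 (m : ℕ) (hm : 2 ≤ m) (q φ : ℝ → ℝ) (hq : Continuous q) (hq0 : ∀ x, 0 ≤ q x)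
    (C ω : ℝ) (hC : 0 < C) (hω : 2 < ω) (hqb : ∀ x, 0 ≤ x → q x ≤ C * (1 + x) ^ (-ω))
    (hφc : Continuous φ) (h1 : ∀ r, 1 ≤ φ r) (hφ : ∀ r, HasDerivAt φ (r * HH m q φ r) r) :
    ∃ c₂ > (0:ℝ), ∀ r, 0 ≤ r → φ r ≤ c₂ := by
  have hφ0 : ∀ r, 0 ≤ φ r := fun r => zero_le_one.trans (h1 r)
  have hmono : MonotoneOn φ (Ici 0) := mono_aux φ _ 0 (fun r _ => hφ r)
    (fun r hr => mul_nonneg hr (HH_nonneg m q φ hq0 hφ0 r))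
  obtain ⟨w, hw2, hw3, hwω⟩ : ∃ w : ℝ, 2 < w ∧ w < 3 ∧ w ≤ ω :=
    ⟨min ω (5/2), lt_min hω (by norm_num), (min_le_right _ _).trans_lt (by norm_num),
      min_le_left _ _⟩
  have hwpos : 0 < 3 - w := by linarith
  have hH : ∀ r, 0 ≤ r → HH m q φ r ≤ C / (3 - w) * (1 + r) ^ (-w) * φ r := by
    intro r hr
    have hi : ∫ t in (0:ℝ)..1, (C * (1 + r) ^ (-w) * φ r) * t ^ (2 - w) =
        C / (3 - w) * (1 + r) ^ (-w) * φ r := by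
      rw [intervalIntegral.integral_const_mul, integral_rpow (Or.inl (by linarith))]
      have e : 2 - w + 1 = 3 - w := by ring
      rw [e, Real.one_rpow, Real.zero_rpow hwpos.ne']
      ring
    rw [← hi]
    unfold HH
    apply intervalIntegral.integral_mono_on_of_le_Ioo zero_le_one
    · apply Continuous.intervalIntegrable; fun_prop
    · exact (intervalIntegral.intervalIntegrable_rpow' (by linarith)).const_mul _
    · intro t ht
      have ht0 := ht.1
      have ht1 := ht.2.le
      have hrt : 0 ≤ r * t := mul_nonneg hr ht0.le
      have a1 : φ (r * t) ≤ φ r := hmono hrt hr (mul_le_of_le_one_right hr ht1)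
      have a2 : q (r * t) ≤ C * ((1 + r) ^ (-w) * t ^ (-w)) := by
        refine (hqb _ hrt).trans (mul_le_mul_of_nonneg_left ?_ hC.le)
        calc (1 + r * t) ^ (-ω) ≤ (1 + r * t) ^ (-w) :=
              Real.rpow_le_rpow_of_exponent_le (by linarith) (by linarith)
          _ ≤ ((1 + r) * t) ^ (-w) :=
              Real.rpow_le_rpow_of_nonpos (by positivity) (by nlinarith) (by linarith)
          _ = _ := Real.mul_rpow (by positivity) ht0.le
      have a3 : t ^ m ≤ t ^ (2:ℝ) := by
        rw [show (2:ℝ) = ((2:ℕ) : ℝ) by norm_num, Real.rpow_natCast]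
        exact pow_le_pow_of_le_one ht0.le ht1 hm
      calc t ^ m * q (r * t) * φ (r * t)
          ≤ t ^ (2:ℝ) * (C * ((1 + r) ^ (-w) * t ^ (-w))) * φ r := by
            have := hq0 (r * t)
            have := hφ0 (r * t)
            gcongr
        _ = (C * (1 + r) ^ (-w) * φ r) * (t ^ (2:ℝ) * t ^ (-w)) := by ring
        _ = _ := by rw [← Real.rpow_add ht0, ← sub_eq_add_neg]
  refine ⟨φ 0 * Real.exp (C / (3 - w) / (w - 2)), mul_pos (zero_lt_one.trans_le (h1 0))
    (Real.exp_pos _), fun r hr => ?_⟩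
  refine gronwall_aux φ _ 0 (C / (3 - w)) (w - 2) le_rfl (by positivity) (by linarith) hφ
    (fun r _ => hφ0 r) ?_ r hr
  intro r hr
  have e : (-1 - (w - 2)) = 1 + -w := by ring
  rw [e, Real.rpow_add (by linarith), Real.rpow_one]
  have b1 := hH r hr
  have b2 : 0 ≤ C / (3 - w) * (1 + r) ^ (-w) * φ r := by
    have := hφ0 r
    positivity
  nlinarith

lemma case2 (q φ : ℝ → ℝ) (hq : Continuous q) (hq0 : ∀ x, 0 ≤ q x)
    (C ω : ℝ) (hC : 0 < C) (hω : 2 < ω) (hqb : ∀ x, 0 ≤ x → q x ≤ C * (1 + x) ^ (-ω))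
    (hφc : Continuous φ) (h1 : ∀ r, 1 ≤ φ r) (hφ : ∀ r, HasDerivAt φ (r * HH 1 q φ r) r)
    (hF : ∀ r, HasDerivAt (fun r => r ^ 2 * HH 1 q φ r) (r ^ 1 * (q r * φ r)) r)
    (hnt : ∃ r, 0 ≤ r ∧ q r ≠ 0) :
    ∃ c₁ > (0:ℝ), ∃ c₂ > (0:ℝ), ∀ r, 0 ≤ r →
      c₁ * Real.log (r + 2) ≤ φ r ∧ φ r ≤ c₂ * Real.log (r + 2) := by
  have hφ0 : ∀ r, 0 ≤ φ r := fun r => zero_le_one.trans (h1 r)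
  have hmono : MonotoneOn φ (Ici 0) := mono_aux φ _ 0 (fun r _ => hφ r)
    (fun r hr => mul_nonneg hr (HH_nonneg 1 q φ hq0 hφ0 r))
  set F : ℝ → ℝ := fun r => r ^ 2 * HH 1 q φ r with hFdef
  have hF0 : ∀ r, 0 ≤ F r := fun r => mul_nonneg (sq_nonneg r) (HH_nonneg 1 q φ hq0 hφ0 r)
  have hFder0 : ∀ r, 0 ≤ r → 0 ≤ r ^ 1 * (q r * φ r) := fun r hr => by
    have := hq0 r
    have := hφ0 r
    positivity
  have hFmono : MonotoneOn F (Ici 0) := mono_aux F _ 0 (fun r _ => hF r) hFder0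
  have hφF : ∀ r, 0 < r → HasDerivAt φ (F r / r) r := fun r hr => by
    convert hφ r using 1
    simp only [hFdef]
    field_simp
  -- lower bound
  obtain ⟨r0, hr0, hb⟩ : ∃ r0, 0 < r0 ∧ 0 < F r0 := by
    by_contra! hcon
    have hz : ∀ r, 0 < r → q r = 0 := by
      intro r hr
      have e : F =ᶠ[𝓝 r] fun _ => 0 := by
        filter_upwards [lt_mem_nhds hr] with s hs
        exact le_antisymm (hcon s hs) (hF0 s)
      have := ((hF r).congr_of_eventuallyEq e.symm).unique (hasDerivAt_const r (0:ℝ))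
      have h3 : φ r ≠ 0 := (zero_lt_one.trans_le (h1 r)).ne'
      simpa [hr.ne', h3] using this
    obtain ⟨r, hr, hqr⟩ := hnt
    have hcl : IsClosed {x | q x = 0} := isClosed_eq hq continuous_const
    have : closure (Ioi (0:ℝ)) ⊆ {x | q x = 0} := hcl.closure_subset_iff.2 hz
    rw [closure_Ioi] at this
    exact hqr (this hr)
  have hlow : ∀ r, r0 ≤ r → 1 + F r0 * (Real.log r - Real.log r0) ≤ φ r := by
    intro r hr
    have := mono_aux (fun r => φ r - F r0 * Real.log r) (fun r => F r / r - F r0 * r⁻¹) r0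
      (fun s hs => (hφF s (hr0.trans_le hs)).sub
        ((Real.hasDerivAt_log (hr0.trans_le hs).ne').const_mul _))
      (fun s hs => by
        have hs0 := hr0.trans_le hs
        have : F r0 ≤ F s := hFmono hr0.le hs0.le hs
        rw [← div_eq_mul_inv, ← _root_.sub_div]
        exact div_nonneg (by linarith) hs0.le) self_mem_Ici hr hr
    simp only at this
    have := h1 r0
    linarith
  -- upper bound
  have hup : ∀ r, 1 ≤ r → φ r ≤ φ 1 + F r * Real.log r := by
    intro r hr
    have := mono_aux (fun r => F r * Real.log r - φ r)
      (fun r => (r ^ 1 * (q r * φ r)) * Real.log r + F r * r⁻¹ - F r / r) 1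
      (fun s hs => ((hF s).mul (Real.hasDerivAt_log (by linarith))).sub (hφF s (by linarith)))
      (fun s hs => by
        have a1 := hFder0 s (by linarith)
        have a2 := Real.log_nonneg hs
        rw [← div_eq_mul_inv, add_sub_cancel_right]
        positivity) self_mem_Ici hr hr
    simp only [Real.log_one, mul_zero] at this
    linarith
  have hφ1 := h1 1
  set ε : ℝ := (ω - 2) / 2 with hεdef
  have hε : 0 < ε := by rw [hεdef]; linarith
  have hg := gronwall_aux (fun r => φ 1 + F r) (fun r => r ^ 1 * (q r * φ r)) 1
    (C * (1 + 1 / ε)) ε zero_le_one (by positivity) hε (fun r => (hF r).const_add _)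
    (fun r _ => add_nonneg (hφ0 1) (hF0 r))
    (fun r hr => by
      have hr0 : 0 ≤ r := by linarith
      have a1 := hqb r hr0
      have a2 := hup r hr
      have hlog0 := Real.log_nonneg hr
      have hp1 : 1 ≤ (1 + r) ^ ε := Real.one_le_rpow (by linarith) hε.le
      have a3 : 1 + Real.log r ≤ (1 + 1 / ε) * (1 + r) ^ ε := by
        have b1 : Real.log r ≤ r ^ ε / ε := Real.log_le_rpow_div hr0 hε
        have b2 : r ^ ε ≤ (1 + r) ^ ε := Real.rpow_le_rpow hr0 (by linarith) hε.le
        have b3 : r ^ ε / ε ≤ (1 + r) ^ ε / ε := by gcongr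
        have b4 : (1 + 1 / ε) * (1 + r) ^ ε = (1 + r) ^ ε + (1 + r) ^ ε / ε := by ring
        rw [b4]; linarith
      have a4 : φ r ≤ (1 + Real.log r) * (φ 1 + F r) := by nlinarith [hF0 r]
      have a5 : (1 + r) ^ (-1 - ε) = (1 + r) * (1 + r) ^ (-ω) * (1 + r) ^ ε := by
        rw [← Real.rpow_one_add' (by linarith) (by linarith), ← Real.rpow_add (by linarith)]
        congr 1
        rw [hεdef]; ring
      have hFr := hF0 r
      have hω0 : 0 ≤ (1 + r) ^ (-ω) := Real.rpow_nonneg (by linarith) _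
      calc r ^ 1 * (q r * φ r)
          ≤ (1 + r) * ((C * (1 + r) ^ (-ω)) * (((1 + 1 / ε) * (1 + r) ^ ε) * (φ 1 + F r))) := by
            rw [pow_one]
            have := hq0 r
            have := hφ0 r
            gcongr
            · linarith
            · exact a4.trans (by gcongr)
        _ = _ := by rw [a5]; ring)
  set B : ℝ := (φ 1 + F 1) * Real.exp (C * (1 + 1 / ε) / ε) with hB
  have hB0 : 0 ≤ B := mul_nonneg (add_nonneg (hφ0 1) (hF0 1)) (Real.exp_pos _).le
  have hl : 0 < Real.log (r0 + 2) := Real.log_pos (by linarith)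
  refine ⟨min (F r0) (1 / Real.log (r0 + 2)), lt_min hb (by positivity), 2 * (φ 1 + B),
    by linarith, fun r hr => ⟨?_, ?_⟩⟩
  · set c := min (F r0) (1 / Real.log (r0 + 2)) with hc
    have c0 : 0 < c := lt_min hb (by positivity)
    have c1 : c ≤ F r0 := min_le_left _ _
    have c2 : c * Real.log (r0 + 2) ≤ 1 := (le_div_iff₀ hl).1 (min_le_right _ _)
    rcases le_total r r0 with h | h
    · have : Real.log (r + 2) ≤ Real.log (r0 + 2) := Real.log_le_log (by linarith) (by linarith)
      have := h1 r
      nlinarith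
    · have hrp : 0 < r := by linarith
      have d1 := hlow r h
      have d2 : Real.log (r + 2) + Real.log r0 ≤ Real.log r + Real.log (r0 + 2) := by
        rw [← Real.log_mul (by linarith) hr0.ne', ← Real.log_mul hrp.ne' (by linarith)]
        apply Real.log_le_log (by positivity)
        nlinarith
      have d3 : 0 ≤ Real.log r - Real.log r0 := by
        have := Real.log_le_log hr0 h
        linarith
      nlinarith
  · have l2 : (1:ℝ)/2 ≤ Real.log (r + 2) := by
      have := Real.log_two_gt_d9
      have := Real.log_le_log (show (0:ℝ) < 2 by norm_num) (show 2 ≤ r + 2 by linarith)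
      linarith
    rcases le_total r 1 with h | h
    · have : φ r ≤ φ 1 := hmono hr (zero_le_one (α := ℝ)) h
      nlinarith
    · have e1 := hup r h
      have e2 := hg r h
      have e3 : F r ≤ B := by linarith
      have e4 : Real.log r ≤ Real.log (r + 2) := Real.log_le_log (by linarith) (by linarith)
      have e5 := Real.log_nonneg h
      have e6 : F r * Real.log r ≤ B * Real.log (r + 2) := by gcongr
      nlinarith

theorem exists_phi0
    (n : ℕ) (hn : 2 ≤ n) (V : EuclideanSpace ℝ (Fin n) → ℝ)
    (hVcont : Continuous V) (hVnn : ∀ x, 0 ≤ V x)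
    (hVrad : ∃ g : ℝ → ℝ, ∀ x, V x = g ‖x‖)
    (C ω : ℝ) (hC : 0 < C) (hω : 2 < ω)
    (hVbd : ∀ x, V x ≤ C * (1 + ‖x‖) ^ (-ω))
    (hVhold : ∃ δ : ℝ≥0, 0 < δ ∧ ∃ K : ℝ≥0,
      HolderOnWith K δ V (closedBall (0 : EuclideanSpace ℝ (Fin n)) (δ : ℝ)))
    (hVnt : n = 2 → V ≠ 0) :
    ∃ φ₀ : EuclideanSpace ℝ (Fin n) → ℝ, ContDiff ℝ 2 φ₀ ∧
      (∀ x, lap φ₀ x = V x * φ₀ x) ∧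
      ∃ c₁ > (0:ℝ), ∃ c₂ > (0:ℝ),
        (n = 2 → ∀ x, c₁ * Real.log (‖x‖ + 2) ≤ φ₀ x ∧ φ₀ x ≤ c₂ * Real.log (‖x‖ + 2)) ∧
        (3 ≤ n → ∀ x, c₁ ≤ φ₀ x ∧ φ₀ x ≤ c₂) := by
  obtain ⟨g, hg⟩ := hVrad
  obtain ⟨m, rfl⟩ : ∃ m, n = m + 1 := ⟨n - 1, by omega⟩
  let e : EuclideanSpace ℝ (Fin (m + 1)) := EuclideanSpace.single 0 1
  have he : ‖e‖ = 1 := by simp [e]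
  let q : ℝ → ℝ := fun r => V (r • e)
  have hq : Continuous q := by
    show Continuous (fun r : ℝ => V (r • e))
    fun_prop
  have hqV : ∀ x, V x = q ‖x‖ := by
    intro x
    simp only [q]
    rw [hg, hg, norm_smul, he]
    simp
  have hq0 : ∀ x, 0 ≤ q x := fun x => hVnn _
  have hqb : ∀ x, 0 ≤ x → q x ≤ C * (1 + x) ^ (-ω) := by
    intro x hx
    have := hVbd (x • e)
    rwa [norm_smul, he, mul_one, Real.norm_eq_abs, abs_of_nonneg hx] at this
  have hqC : ∀ x, q x ≤ C := by
    intro x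
    refine (hVbd (x • e)).trans (mul_le_of_le_one_right hC.le ?_)
    exact Real.rpow_le_one_of_one_le_of_nonpos (by linarith [norm_nonneg (x • e)]) (by linarith)
  obtain ⟨φ, hφc, h1, hφ, hF⟩ := exists_phi m q hq hq0 C hC hqC
  have hr := radial_main (n := m + 1) φ (HH m q φ) (fun r => q r * φ r) (HH_cont m q φ hq hφc)
    (hq.mul hφc) (by omega) (HH_zero m q φ) hφ hF
  refine ⟨fun y => φ ‖y‖, hr.1, fun x => by rw [hr.2 x, hqV x], ?_⟩
  by_cases hm : m = 1
  · subst hm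
    have hnt : ∃ r, 0 ≤ r ∧ q r ≠ 0 := by
      have h2 := hVnt rfl
      obtain ⟨x, hx⟩ := Function.ne_iff.1 h2
      exact ⟨‖x‖, norm_nonneg x, by rw [← hqV]; exact hx⟩
    obtain ⟨c₁, hc₁, c₂, hc₂, h⟩ := case2 q φ hq hq0 C ω hC hω hqb hφc h1 hφ hF hnt
    exact ⟨c₁, hc₁, c₂, hc₂, fun _ x => h _ (norm_nonneg x), fun h3 => by omega⟩
  · obtain ⟨c₂, hc₂, h⟩ := case3 m (by omega) q φ hq hq0 C ω hC hω hqb hφc h1 hφ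
    exact ⟨1, one_pos, c₂, hc₂, fun h3 => by omega, fun _ x => ⟨h1 _, h _ (norm_nonneg x)⟩⟩
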